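/- Localized L¹ estimate for the quadratic-in-η error term: there exist constants δ₀ > 0, A₀ > 0 and C > 0 such that for every A ≥ A₀, every δ ∈ (0, δ₀), every z ∈ ℂ² with |z| ≤ δ, and every measurable η₁ : ℝ → ℝ with ‖η₁‖_{L²(ℝ)} ≤ δ, one has ‖ χ(x/A) ( f(Φ[z]₁ + η₁) - f(Φ[z]₁) - p|Φ[z]₁|^{p-1} η₁ ) ‖_{L¹(ℝ)} ≤ C A^{1 - p/2} δ^{p-1} ‖ sech(2x/A) η₁ ‖_{L²(ℝ)}. -/

import Mathlib

open Real

/-- The soliton `Q(x) = ((p+1)/2)^{1/(p-1)} (sech(β₀x))^{2/(p-1)}` with `β₀ = (p-1)/2`,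
where `sech t = 1 / cosh t`. -/
noncomputable def solitonQ (p : ℝ) : ℝ → ℝ :=
  fun x => ((p + 1) / 2) ^ (1 / (p - 1)) * ((Real.cosh ((p - 1) / 2 * x))⁻¹) ^ (2 / (p - 1))

/-- The nonlinearity `f(u) = |u|^{p-1} u`. -/
noncomputable def fNL (p : ℝ) : ℝ → ℝ :=
  fun u => |u| ^ (p - 1) * u

/-- The operator `(S_j* g)(x) = -g'(x) - k tanh(β₀x) g(x)` with `β₀ = (p-1)/2`,
for a constant `k`. -/
noncomputable def Sstar (p k : ℝ) (g : ℝ → ℝ) : ℝ → ℝ :=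
  fun x => -(deriv g x) - k * Real.tanh ((p - 1) / 2 * x) * g x

/-- `φ₀ = Q^{k₀}` with `k₀ = (p+1)/2`. -/
noncomputable def phi0 (p : ℝ) : ℝ → ℝ :=
  fun x => solitonQ p x ^ ((p + 1) / 2)

/-- `φ₂ = S₀*(S₁*(Q^{k₂}))` where `k₀ = (p+1)/2`, `k₁ = 1`, `k₂ = (3-p)/2`. -/
noncomputable def phi2 (p : ℝ) : ℝ → ℝ :=
  Sstar p ((p + 1) / 2) (Sstar p 1 (fun x => solitonQ p x ^ ((3 - p) / 2)))

/-- `Φ[z]₁ = Q + Re((1-i)z₁) φ₀ + 2 Re(z₂) φ₂` for `z = (z₁, z₂) ∈ ℂ²`. -/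
noncomputable def PhiZ1 (p : ℝ) (z : ℂ × ℂ) : ℝ → ℝ :=
  fun x => solitonQ p x + ((1 - Complex.I) * z.1).re * phi0 p x + 2 * z.2.re * phi2 p x

theorem hasDerivAt_fNL {p : ℝ} (hp : 1 < p) (x : ℝ) :
    HasDerivAt (fNL p) (p * |x| ^ (p - 1)) x := by
  rcases lt_trichotomy x 0 with hx | rfl | hx
  · have h := ((hasDerivAt_neg x).rpow_const (p := p) (Or.inl (by linarith : -x ≠ 0))).neg
    rw [abs_of_neg hx]
    refine (h.congr_of_eventuallyEq ?_).congr_deriv (by ring)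
    filter_upwards [eventually_lt_nhds hx] with y hy
    have hy' : -y ≠ 0 := by linarith
    have hy0 : y ≠ 0 := hy.ne
    simp only [fNL, Pi.neg_apply, abs_of_neg hy, Real.rpow_sub_one hy']
    field_simp
  · rw [abs_zero, Real.zero_rpow (by linarith), mul_zero, hasDerivAt_iff_tendsto_slope_zero]
    have h : ContinuousAt (fun t : ℝ => |t| ^ (p - 1)) 0 :=
      continuous_abs.continuousAt.rpow_const (Or.inr (by linarith))
    have h' := h.tendsto
    simp only [abs_zero, Real.zero_rpow (by linarith : p - 1 ≠ 0)] at h'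
    refine (h'.mono_left nhdsWithin_le_nhds).congr' ?_
    filter_upwards [self_mem_nhdsWithin] with t ht
    have ht' : t ≠ 0 := ht
    simp only [fNL, zero_add, mul_zero, sub_zero, smul_eq_mul]
    field_simp
  · have h := (hasDerivAt_id x).rpow_const (p := p) (Or.inl hx.ne')
    rw [abs_of_pos hx]
    refine (h.congr_of_eventuallyEq ?_).congr_deriv (by simp)
    filter_upwards [eventually_gt_nhds hx] with y hy
    simp only [fNL, id, abs_of_pos hy, Real.rpow_sub_one hy.ne']
    field_simp

theorem abs_rpow_abs_sub_le {q : ℝ} (hq0 : 0 ≤ q) (hq1 : q ≤ 1) (a b : ℝ) :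
    |(|a| ^ q - |b| ^ q)| ≤ |a - b| ^ q := by
  have key : ∀ u v : ℝ, |u| ^ q ≤ |u - v| ^ q + |v| ^ q := fun u v =>
    calc |u| ^ q ≤ (|u - v| + |v|) ^ q :=
          Real.rpow_le_rpow (abs_nonneg _) (by simpa using abs_add_le (u - v) v) hq0
      _ ≤ _ := Real.rpow_add_le_add_rpow (abs_nonneg _) (abs_nonneg _) hq0 hq1
  have h₁ := key a b
  have h₂ := key b a
  rw [abs_sub_comm b a] at h₂
  exact abs_le.2 ⟨by linarith, by linarith⟩

theorem abs_fNL_add_sub_sub_le {p : ℝ} (hp1 : 1 < p) (hp2 : p ≤ 2) (a h : ℝ) :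
    |fNL p (a + h) - fNL p a - p * |a| ^ (p - 1) * h| ≤ 2 * (|h| ^ (p - 1) * |h|) := by
  have hbound : ∀ t ∈ Set.uIcc a (a + h),
      ‖p * |t| ^ (p - 1) - p * |a| ^ (p - 1)‖ ≤ 2 * |h| ^ (p - 1) := by
    intro t ht
    have hth : |t - a| ≤ |h| := by
      simpa using Set.abs_sub_left_of_mem_uIcc ht
    rw [← mul_sub, Real.norm_eq_abs, abs_mul, abs_of_pos (by linarith : 0 < p)]
    gcongr
    exact (abs_rpow_abs_sub_le (by linarith) (by linarith) t a).trans
      (Real.rpow_le_rpow (abs_nonneg _) hth (by linarith))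
  have hmv := (convex_uIcc a (a + h)).norm_image_sub_le_of_norm_hasDerivWithin_le
    (f := fun t => fNL p t - t * (p * |a| ^ (p - 1)))
    (fun t _ => ((hasDerivAt_fNL hp1 t).sub
      (hasDerivAt_mul_const (p * |a| ^ (p - 1)))).hasDerivWithinAt)
    hbound Set.left_mem_uIcc Set.right_mem_uIcc
  rw [Real.norm_eq_abs, Real.norm_eq_abs, add_sub_cancel_left, mul_assoc] at hmv
  convert hmv using 2
  ring

open MeasureTheory in
theorem lintegral_enorm_rpow_mul_enorm_le {α : Type*} [MeasurableSpace α] {μ : Measure α}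
    {q : ℝ} (hq0 : 0 < q) (hq1 : q ≤ 1) {g : α → ℝ} (hg : AEStronglyMeasurable g μ) :
    ∫⁻ x, ‖g x‖ₑ ^ q * ‖g x‖ₑ ∂μ ≤
      (eLpNorm g 2 μ ^ q * μ Set.univ ^ ((1 - q) / 2)) * eLpNorm g 2 μ := by
  have hL2 : eLpNorm g 2 μ = (∫⁻ x, ‖g x‖ₑ ^ (2 : ℝ) ∂μ) ^ (1 / (2 : ℝ)) := by
    simp [eLpNorm_eq_lintegral_rpow_enorm_toReal (p := 2) (by simp) (by simp)]
  have hholder := ENNReal.lintegral_mul_le_Lp_mul_Lq μ Real.HolderConjugate.two_two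
    (hg.enorm.pow_const q) hg.enorm
  simp only [Pi.mul_apply] at hholder
  rw [← hL2] at hholder
  refine hholder.trans (mul_le_mul_left ?_ _)
  have hpow : (∫⁻ x, (‖g x‖ₑ ^ q) ^ (2 : ℝ) ∂μ) ^ (1 / (2 : ℝ)) =
      eLpNorm' g (2 * q) μ ^ q := by
    rw [eLpNorm', ← ENNReal.rpow_mul]
    simp only [← ENNReal.rpow_mul]
    congr 1
    · simp only [mul_comm]
    · field_simp
  have hmono := eLpNorm'_le_eLpNorm'_mul_rpow_measure_univ (p := 2 * q) (q := 2) (by positivity)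
    (by linarith) hg
  have hL2' : eLpNorm' g 2 μ = eLpNorm g 2 μ := by
    rw [hL2, eLpNorm']
  rw [hpow]
  refine (ENNReal.rpow_le_rpow hmono hq0.le).trans_eq ?_
  rw [hL2', ENNReal.mul_rpow_of_nonneg _ _ hq0.le, ← ENNReal.rpow_mul]
  congr 2
  field_simp

open MeasureTheory in
theorem stmt16 (p : ℝ) (hp1 : 5 / 3 < p) (hp2 : p ≤ 2)
    (χ : ℝ → ℝ) (hχ : ContDiff ℝ (⊤ : ℕ∞) χ) (hχc : HasCompactSupport χ)
    (hχ01 : ∀ x, χ x ∈ Set.Icc (0 : ℝ) 1)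
    (hχ1 : ∀ x ∈ Set.Icc (-1 : ℝ) 1, χ x = 1)
    (hχ0 : ∀ x : ℝ, 2 < |x| → χ x = 0)
    (hχeven : ∀ x : ℝ, χ (-x) = χ x) :
    ∃ δ₀ > (0 : ℝ), ∃ A₀ > (0 : ℝ), ∃ C > (0 : ℝ), ∀ A : ℝ, A₀ ≤ A →
      ∀ δ : ℝ, 0 < δ → δ < δ₀ → ∀ z : ℂ × ℂ, ‖z‖ ≤ δ →
        ∀ η₁ : ℝ → ℝ, Measurable η₁ →
          eLpNorm η₁ 2 volume ≤ ENNReal.ofReal δ →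
            eLpNorm
                (fun x => χ (x / A) *
                  (fNL p (PhiZ1 p z x + η₁ x) - fNL p (PhiZ1 p z x)
                    - p * |PhiZ1 p z x| ^ (p - 1) * η₁ x)) 1 volume
              ≤ ENNReal.ofReal (C * A ^ (1 - p / 2) * δ ^ (p - 1)) *
                  eLpNorm (fun x => (Real.cosh (2 * x / A))⁻¹ * η₁ x) 2 volume := by
  have hq0 : 0 < p - 1 := by linarith
  have hq1 : p - 1 ≤ 1 := by linarith
  refine ⟨1, one_pos, 1, one_pos, 2 * 4 ^ (1 - p / 2) * Real.cosh 4, by positivity, ?_⟩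
  intro A hA δ hδ _ z _ η hη hηδ
  have hA0 : 0 < A := by linarith
  set s : Set ℝ := Set.Icc (-(2 * A)) (2 * A) with hs
  have hsm : MeasurableSet s := measurableSet_Icc
  have hμs : (volume.restrict s) Set.univ = ENNReal.ofReal (4 * A) := by
    rw [Measure.restrict_apply_univ, hs, Real.volume_Icc]
    congr 1
    ring
  have hpt : ∀ x, ‖χ (x / A) * (fNL p (PhiZ1 p z x + η x) - fNL p (PhiZ1 p z x)
      - p * |PhiZ1 p z x| ^ (p - 1) * η x)‖ₑ ≤
        s.indicator (fun x => 2 * (‖η x‖ₑ ^ (p - 1) * ‖η x‖ₑ)) x := by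
    intro x
    by_cases hx : x ∈ s
    · rw [Set.indicator_of_mem hx, enorm_mul]
      have h1 : ‖χ (x / A)‖ₑ ≤ 1 := by
        rw [Real.enorm_of_nonneg (hχ01 _).1]
        exact ENNReal.ofReal_le_one.2 (hχ01 _).2
      have h2 := ENNReal.ofReal_le_ofReal
        (abs_fNL_add_sub_sub_le (by linarith) hp2 (PhiZ1 p z x) (η x))
      rw [ENNReal.ofReal_mul two_pos.le, ENNReal.ofReal_mul (by positivity),
        ← ENNReal.ofReal_rpow_of_nonneg (abs_nonneg _) hq0.le, ← Real.enorm_eq_ofReal_abs,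
        ← Real.enorm_eq_ofReal_abs, ENNReal.ofReal_ofNat] at h2
      simpa using mul_le_mul' h1 h2
    · have : 2 < |x / A| := by
        rw [abs_div, abs_of_pos hA0, lt_div_iff₀ hA0]
        by_contra! h
        exact hx (abs_le.1 h)
      simp [hχ0 _ this]
  have hsech : eLpNorm η 2 (volume.restrict s) ≤ ENNReal.ofReal (Real.cosh 4) *
      eLpNorm (fun x => (Real.cosh (2 * x / A))⁻¹ * η x) 2 volume := by
    refine (eLpNorm_le_mul_eLpNorm_of_ae_le_mul (c := Real.cosh 4)
      (g := fun x => (Real.cosh (2 * x / A))⁻¹ * η x) ?_ 2).trans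
        (mul_le_mul_right (eLpNorm_mono_measure _ Measure.restrict_le_self) _)
    filter_upwards [ae_restrict_mem hsm] with x hx
    have hc : Real.cosh (2 * x / A) ≤ Real.cosh 4 := by
      rw [Real.cosh_le_cosh, abs_div, abs_of_pos hA0, div_le_iff₀ hA0, abs_mul]
      have := abs_le.2 hx
      norm_num
      linarith
    rw [norm_mul, norm_inv, Real.norm_of_nonneg (Real.cosh_pos _).le, ← mul_assoc,
      ← div_eq_mul_inv]
    exact le_mul_of_one_le_left (norm_nonneg _) ((one_le_div (Real.cosh_pos _)).2 hc)
  have hδs : eLpNorm η 2 (volume.restrict s) ≤ ENNReal.ofReal δ :=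
    (eLpNorm_mono_measure _ Measure.restrict_le_self).trans hηδ
  have hexp : (1 - (p - 1)) / 2 = 1 - p / 2 := by ring
  calc
    _ ≤ 2 * ∫⁻ x in s, ‖η x‖ₑ ^ (p - 1) * ‖η x‖ₑ := by
      rw [eLpNorm_one_eq_lintegral_enorm]
      refine (lintegral_mono hpt).trans_eq ?_
      rw [lintegral_indicator hsm, lintegral_const_mul' _ _ (by simp)]
    _ ≤ 2 * ((ENNReal.ofReal δ ^ (p - 1) * ENNReal.ofReal (4 * A) ^ (1 - p / 2)) *
        (ENNReal.ofReal (Real.cosh 4) *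
          eLpNorm (fun x => (Real.cosh (2 * x / A))⁻¹ * η x) 2 volume)) := by
      refine mul_le_mul_right ((lintegral_enorm_rpow_mul_enorm_le hq0 hq1
        hη.aestronglyMeasurable).trans ?_) _
      rw [hμs, hexp]
      gcongr
    _ = _ := by
      rw [ENNReal.ofReal_rpow_of_pos hδ, ENNReal.ofReal_rpow_of_pos (by positivity),
        ← ENNReal.ofReal_mul (by positivity), ← mul_assoc, ← mul_assoc,
        ← ENNReal.ofReal_ofNat 2, ← ENNReal.ofReal_mul (by positivity),
        ← ENNReal.ofReal_mul (by positivity),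
        Real.mul_rpow (by positivity) hA0.le]
      congr 2
      ring
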